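/- arXiv:1003.4179 — 3 statements merged into one kernel-verified Lean document; each statement's English description precedes it below -/
import Mathlib

section
/- Let E be a complete geodesic metric space with convex metric, the geodesic extension property and curvature bounded below by κ<0, and let A be a nonempty, bounded and closed subset of E. Then the set W_max = { X ∈ P_{b,cl,cv}(E) : max(A,X) is well-posed } is a dense G_δ-set in the metric space (P_{b,cl,cv}(E), h). -/
open Metric Set Filter Bornology

noncomputable section

/-- A geodesic path of length `l`: a map `c : ℝ → E` that is isometric on `[0, l]`. -/
def IsGeodesicPath {E : Type*} [MetricSpace E] (c : ℝ → E) (l : ℝ) : Prop :=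
  0 ≤ l ∧ ∀ s ∈ Icc (0:ℝ) l, ∀ t ∈ Icc (0:ℝ) l, dist (c s) (c t) = |s - t|

/-- `S` is a geodesic segment joining `x` and `y`. -/
def IsGeodesicSegment {E : Type*} [MetricSpace E] (S : Set E) (x y : E) : Prop :=
  ∃ c l, IsGeodesicPath c l ∧ c 0 = x ∧ c l = y ∧ S = c '' Icc (0:ℝ) l

/-- A geodesic (line): an isometric image of `ℝ`. -/
def IsGeodesicLine {E : Type*} [MetricSpace E] (S : Set E) : Prop :=
  ∃ c : ℝ → E, Isometry c ∧ S = Set.range c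

/-- `E` is a geodesic space: every two points are joined by a geodesic path. -/
def IsGeodesicSpace (E : Type*) [MetricSpace E] : Prop :=
  ∀ x y : E, ∃ S, IsGeodesicSegment S x y

/-- `E` has the geodesic extension property: every geodesic segment is contained
in a geodesic. -/
def GeodesicExtensionProperty (E : Type*) [MetricSpace E] : Prop :=
  ∀ (S : Set E) (x y : E), IsGeodesicSegment S x y → ∃ L, IsGeodesicLine L ∧ S ⊆ L

/-- The metric of `E` is convex. -/
def HasConvexMetric (E : Type*) [MetricSpace E] : Prop :=
  ∀ (c₁ c₂ : ℝ → E) (l₁ l₂ : ℝ), IsGeodesicPath c₁ l₁ → IsGeodesicPath c₂ l₂ →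
    ∀ t ∈ Icc (0:ℝ) 1,
      dist (c₁ (t * l₁)) (c₂ (t * l₂)) ≤
        (1 - t) * dist (c₁ 0) (c₂ 0) + t * dist (c₁ l₁) (c₂ l₂)

/-- A subset `X` is (geodesically) convex: any geodesic segment joining two points
of `X` is contained in `X`. -/
def GeodesicConvex {E : Type*} [MetricSpace E] (X : Set E) : Prop :=
  ∀ x ∈ X, ∀ y ∈ X, ∀ S : Set E, IsGeodesicSegment S x y → S ⊆ X

/-- A function `f : E → ℝ` is (geodesically) convex. -/
def GeodesicConvexFun {E : Type*} [MetricSpace E] (f : E → ℝ) : Prop :=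
  ∀ (c : ℝ → E) (l : ℝ), IsGeodesicPath c l → ∀ t ∈ Icc (0:ℝ) 1,
    f (c (t * l)) ≤ (1 - t) * f (c 0) + t * f (c l)

/-- `G₁(S)`: the union of all geodesic segments with endpoints in `S`. -/
def geodSegUnion {E : Type*} [MetricSpace E] (S : Set E) : Set E :=
  {z | ∃ x ∈ S, ∃ y ∈ S, ∃ T : Set E, IsGeodesicSegment T x y ∧ z ∈ T}

/-- The iterates `G_n(S)`. -/
def geodGn {E : Type*} [MetricSpace E] (S : Set E) : ℕ → Set E
  | 0 => S
  | n + 1 => geodSegUnion (geodGn S n)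

/-- The (geodesic) convex hull `co(S) = ⋃ₙ G_n(S)`. -/
def geodConvexHull {E : Type*} [MetricSpace E] (S : Set E) : Set E :=
  ⋃ n, geodGn S n

/-- `E` is without bifurcating geodesics. -/
def NoBifurcatingGeodesics (E : Type*) [MetricSpace E] : Prop :=
  ∀ (p a b : E) (S₁ S₂ : Set E), IsGeodesicSegment S₁ p a → IsGeodesicSegment S₂ p b →
    ∀ z, z ∈ S₁ → z ∈ S₂ → z ≠ p → (z = a ∧ z = b) ∨ S₁ ⊆ S₂ ∨ S₂ ⊆ S₁

/-- `E` is reflexive: every descending sequence of nonempty, bounded, closed and convex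
subsets of `E` has nonempty intersection. -/
def ReflexiveGeodesicSpace (E : Type*) [MetricSpace E] : Prop :=
  ∀ C : ℕ → Set E, (∀ n, (C n).Nonempty) → (∀ n, IsBounded (C n)) → (∀ n, IsClosed (C n)) →
    (∀ n, GeodesicConvex (C n)) → (∀ n, C (n + 1) ⊆ C n) → (⋂ n, C n).Nonempty

/-- `Dist(x, A)`: the remotal (farthest) distance from `x` to `A`. -/
def supDist {E : Type*} [MetricSpace E] (x : E) (A : Set E) : ℝ :=
  sSup ((fun a => dist x a) '' A)

/-- `λ_{XY} = inf{ d(x,y) : x ∈ X, y ∈ Y }`. -/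
def infSetDist {E : Type*} [MetricSpace E] (X Y : Set E) : ℝ :=
  sInf (Set.image2 dist X Y)

/-- `μ_{XY} = sup{ d(x,y) : x ∈ X, y ∈ Y }`. -/
def supSetDist {E : Type*} [MetricSpace E] (X Y : Set E) : ℝ :=
  sSup (Set.image2 dist X Y)

/-- `L_{XY}(σ) = { x ∈ X : dist(x,Y) ≤ λ_{XY} + σ }`. -/
def Lset {E : Type*} [MetricSpace E] (X Y : Set E) (σ : ℝ) : Set E :=
  {x ∈ X | infDist x Y ≤ infSetDist X Y + σ}

/-- `M_{XY}(σ) = { x ∈ X : Dist(x,Y) ≥ μ_{XY} − σ }`. -/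
def Mset {E : Type*} [MetricSpace E] (X Y : Set E) (σ : ℝ) : Set E :=
  {x ∈ X | supSetDist X Y - σ ≤ supDist x Y}

/-- The minimization problem `min(X,Y)` is well-posed. -/
def MinWellPosed {E : Type*} [MetricSpace E] (X Y : Set E) : Prop :=
  ∃ x₀ ∈ X, ∃ y₀ ∈ Y, dist x₀ y₀ = infSetDist X Y ∧
    (∀ x ∈ X, ∀ y ∈ Y, dist x y = infSetDist X Y → x = x₀ ∧ y = y₀) ∧
    ∀ x : ℕ → E, ∀ y : ℕ → E, (∀ n, x n ∈ X) → (∀ n, y n ∈ Y) →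
      Tendsto (fun n => dist (x n) (y n)) atTop (nhds (infSetDist X Y)) →
      Tendsto x atTop (nhds x₀) ∧ Tendsto y atTop (nhds y₀)

/-- The maximization problem `max(X,Y)` is well-posed. -/
def MaxWellPosed {E : Type*} [MetricSpace E] (X Y : Set E) : Prop :=
  ∃ x₀ ∈ X, ∃ y₀ ∈ Y, dist x₀ y₀ = supSetDist X Y ∧
    (∀ x ∈ X, ∀ y ∈ Y, dist x y = supSetDist X Y → x = x₀ ∧ y = y₀) ∧
    ∀ x : ℕ → E, ∀ y : ℕ → E, (∀ n, x n ∈ X) → (∀ n, y n ∈ Y) →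
      Tendsto (fun n => dist (x n) (y n)) atTop (nhds (supSetDist X Y)) →
      Tendsto x atTop (nhds x₀) ∧ Tendsto y atTop (nhds y₀)

/-- The distance of the model space `M²_κ` (κ < 0): the hyperbolic distance
multiplied by `1/√(-κ)`. -/
def kdist (κ : ℝ) (a b : UpperHalfPlane) : ℝ :=
  (Real.sqrt (-κ))⁻¹ * dist a b

/-- `pb` is the comparison point in `M²_κ` (relative to the side from `xi` to `xj`,
with comparison vertices `xib`, `xjb`) of a point `p` on a geodesic segment from
`xi` to `xj`. -/
def IsComparisonPoint {E : Type*} [MetricSpace E] (κ : ℝ) (xi xj : E)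
    (xib xjb : UpperHalfPlane) (p : E) (pb : UpperHalfPlane) : Prop :=
  kdist κ xib pb = dist xi p ∧ kdist κ pb xjb = dist p xj

/-- `E` has curvature bounded below by `κ < 0`: every geodesic triangle satisfies the
reversed CAT(κ) inequality with respect to any κ-comparison triangle in `M²_κ`. -/
def CurvBoundedBelow (E : Type*) [MetricSpace E] (κ : ℝ) : Prop :=
  ∀ (x₁ x₂ x₃ : E) (S₁₂ S₂₃ S₁₃ : Set E),
    IsGeodesicSegment S₁₂ x₁ x₂ → IsGeodesicSegment S₂₃ x₂ x₃ → IsGeodesicSegment S₁₃ x₁ x₃ →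
    ∀ x₁b x₂b x₃b : UpperHalfPlane,
      kdist κ x₁b x₂b = dist x₁ x₂ → kdist κ x₂b x₃b = dist x₂ x₃ →
      kdist κ x₁b x₃b = dist x₁ x₃ →
      ∀ (p q : E) (pb qb : UpperHalfPlane),
        ((p ∈ S₁₂ ∧ IsComparisonPoint κ x₁ x₂ x₁b x₂b p pb) ∨
         (p ∈ S₂₃ ∧ IsComparisonPoint κ x₂ x₃ x₂b x₃b p pb) ∨
         (p ∈ S₁₃ ∧ IsComparisonPoint κ x₁ x₃ x₁b x₃b p pb)) →
        ((q ∈ S₁₂ ∧ IsComparisonPoint κ x₁ x₂ x₁b x₂b q qb) ∨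
         (q ∈ S₂₃ ∧ IsComparisonPoint κ x₂ x₃ x₂b x₃b q qb) ∨
         (q ∈ S₁₃ ∧ IsComparisonPoint κ x₁ x₃ x₁b x₃b q qb)) →
        kdist κ pb qb ≤ dist p q

/-- Comparison points for Euclidean (κ = 0) comparison triangles in `ℝ²`. -/
def IsComparisonPointE {E : Type*} [MetricSpace E] (xi xj : E)
    (xib xjb : EuclideanSpace ℝ (Fin 2)) (p : E) (pb : EuclideanSpace ℝ (Fin 2)) : Prop :=
  dist xib pb = dist xi p ∧ dist pb xjb = dist p xj

/-- `E` is a CAT(0) space: a geodesic space where every geodesic triangle satisfies the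
CAT(0) comparison inequality with respect to Euclidean comparison triangles. -/
def CATZero (E : Type*) [MetricSpace E] : Prop :=
  IsGeodesicSpace E ∧
  ∀ (x₁ x₂ x₃ : E) (S₁₂ S₂₃ S₁₃ : Set E),
    IsGeodesicSegment S₁₂ x₁ x₂ → IsGeodesicSegment S₂₃ x₂ x₃ → IsGeodesicSegment S₁₃ x₁ x₃ →
    ∀ x₁b x₂b x₃b : EuclideanSpace ℝ (Fin 2),
      dist x₁b x₂b = dist x₁ x₂ → dist x₂b x₃b = dist x₂ x₃ → dist x₁b x₃b = dist x₁ x₃ →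
      ∀ (p q : E) (pb qb : EuclideanSpace ℝ (Fin 2)),
        ((p ∈ S₁₂ ∧ IsComparisonPointE x₁ x₂ x₁b x₂b p pb) ∨
         (p ∈ S₂₃ ∧ IsComparisonPointE x₂ x₃ x₂b x₃b p pb) ∨
         (p ∈ S₁₃ ∧ IsComparisonPointE x₁ x₃ x₁b x₃b p pb)) →
        ((q ∈ S₁₂ ∧ IsComparisonPointE x₁ x₂ x₁b x₂b q qb) ∨
         (q ∈ S₂₃ ∧ IsComparisonPointE x₂ x₃ x₂b x₃b q qb) ∨
         (q ∈ S₁₃ ∧ IsComparisonPointE x₁ x₃ x₁b x₃b q qb)) →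
        dist p q ≤ dist pb qb

/-- The space `P_{b,cl,cv}(E)` of nonempty, bounded, closed and convex subsets of `E`. -/
def Pbclcv (E : Type*) [MetricSpace E] : Type _ :=
  {X : Set E // X.Nonempty ∧ IsBounded X ∧ IsClosed X ∧ GeodesicConvex X}

/-- `P_{b,cl,cv}(E)` carries the Pompeiu-Hausdorff distance. -/
instance Pbclcv.metricSpace (E : Type*) [MetricSpace E] : MetricSpace (Pbclcv E) where
  dist X Y := hausdorffDist X.1 Y.1
  dist_self X := hausdorffDist_self_zero
  dist_comm X Y := hausdorffDist_comm
  dist_triangle X Y Z := hausdorffDist_triangle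
    (hausdorffEdist_ne_top_of_nonempty_of_bounded X.2.1 Y.2.1 X.2.2.1 Y.2.2.1)
  eq_of_dist_eq_zero := by
    intro X Y h
    exact Subtype.ext ((X.2.2.2.1.hausdorffDist_zero_iff_eq Y.2.2.2.1
      (hausdorffEdist_ne_top_of_nonempty_of_bounded X.2.1 Y.2.1 X.2.2.1 Y.2.2.1)).mp h)

/-- `P^A_{b,cl,cv}(E)`: the closure in `(P_{b,cl,cv}(E), h)` of the family of sets at
positive distance from `A`. -/
def PAbclcv {E : Type*} [MetricSpace E] (A : Set E) : Set (Pbclcv E) :=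
  closure {X : Pbclcv E | 0 < infSetDist X.1 A}

/-- The inverse hyperbolic cosine. -/
def arcosh (x : ℝ) : ℝ := Real.log (x + Real.sqrt (x ^ 2 - 1))

/-- The function `F_κ`. -/
def Fkappa (κ d r σ : ℝ) : ℝ :=
  2 / Real.sqrt (-κ) *
    arcosh (Real.cosh (Real.sqrt (-κ) * (r - d + σ)) ^ 2 -
      Real.sinh (Real.sqrt (-κ) * (r - d + σ)) / Real.sinh (Real.sqrt (-κ) * d) *
        (Real.cosh (Real.sqrt (-κ) * r) -
          Real.cosh (Real.sqrt (-κ) * d) * Real.cosh (Real.sqrt (-κ) * (r - d + σ))))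

/-- The petal `P_{α,δ}(x₀, f)`. -/
def petal {E : Type*} [MetricSpace E] (f : E → ℝ) (α δ : ℝ) (x₀ : E) : Set E :=
  {x | f x ≤ f x₀ - α * dist x x₀ + δ}

/-- `L_{A,f}(σ)`. -/
def LsetFun {E : Type*} [MetricSpace E] (A : Set E) (f : E → ℝ) (σ : ℝ) : Set E :=
  {x | f x ≤ sInf (f '' A) + σ ∧ infDist x A ≤ σ}

/-- The problem `min(A,f)` is well-posed in the sense of Revalski. -/
def RevalskiWellPosed {E : Type*} [MetricSpace E] (A : Set E) (f : E → ℝ) : Prop :=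
  sInf ((fun σ => diam (LsetFun A f σ)) '' Ioi 0) = 0

/-- The nearest point problem `min(X,y)` is well-posed. -/
def PointMinWellPosed {E : Type*} [MetricSpace E] (X : Set E) (y : E) : Prop :=
  ∃ x₀ ∈ X, dist x₀ y = infDist y X ∧ (∀ x ∈ X, dist x y = infDist y X → x = x₀) ∧
    ∀ x : ℕ → E, (∀ n, x n ∈ X) →
      Tendsto (fun n => dist (x n) y) atTop (nhds (infDist y X)) →
      Tendsto x atTop (nhds x₀)

end

section Geodesics

variable {E : Type*} [MetricSpace E]

theorem IsGeodesicPath.exists_mul_eq {c : ℝ → E} {l u : ℝ} (hc : IsGeodesicPath c l)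
    (hu : u ∈ Icc (0 : ℝ) l) : ∃ t ∈ Icc (0 : ℝ) 1, t * l = u := by
  rcases hc.1.eq_or_lt with h | h
  · exact ⟨0, ⟨le_rfl, zero_le_one⟩, by rw [zero_mul]; exact le_antisymm hu.1 (hu.2.trans h.ge)⟩
  · exact ⟨u / l, ⟨div_nonneg hu.1 hc.1, (div_le_one h).2 hu.2⟩, div_mul_cancel₀ u h.ne'⟩

theorem isGeodesicPath_const (a : E) : IsGeodesicPath (fun _ => a) 0 := by
  refine ⟨le_rfl, fun s hs t ht => ?_⟩
  rw [le_antisymm hs.2 hs.1, le_antisymm ht.2 ht.1]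
  simp

/-- Every segment can be prolonged beyond its second endpoint by a prescribed length. -/
theorem GeodesicExtensionProperty.exists_prolongation (hgeo : IsGeodesicSpace E)
    (hext : GeodesicExtensionProperty E) (a x : E) {ε : ℝ} (hε : 0 ≤ ε) :
    ∃ x' S, IsGeodesicSegment S x' a ∧ x ∈ S ∧ dist x x' = ε ∧ dist a x' = dist a x + ε := by
  obtain ⟨S, hS⟩ := hgeo a x
  obtain ⟨L, ⟨c, hc, rfl⟩, hSL⟩ := hext S a x hS
  have hends : a ∈ S ∧ x ∈ S := by
    obtain ⟨b, l, hb, h0, hl, rfl⟩ := hS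
    exact ⟨⟨0, ⟨le_rfl, hb.1⟩, h0⟩, ⟨l, ⟨hb.1, le_rfl⟩, hl⟩⟩
  have key : ∀ (c : ℝ → E), Isometry c → ∀ s t : ℝ, s ≤ t → c s = a → c t = x →
      ∃ x' S, IsGeodesicSegment S x' a ∧ x ∈ S ∧ dist x x' = ε ∧ dist a x' = dist a x + ε := by
    rintro c hc s t hst rfl rfl
    refine ⟨c (t + ε), _, ⟨fun r => c (t + ε - r), t + ε - s, ⟨by linarith, fun p _ q _ => ?_⟩,
      by simp, by simp, rfl⟩, ⟨ε, ⟨hε, by linarith⟩, by simp⟩, ?_, ?_⟩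
    · rw [hc.dist_eq, Real.dist_eq, abs_sub_comm]
      congr 1
      ring
    · rw [hc.dist_eq, dist_comm, Real.dist_eq, add_sub_cancel_left, abs_of_nonneg hε]
    · rw [hc.dist_eq, hc.dist_eq, dist_comm s, dist_comm s, Real.dist_eq, Real.dist_eq,
        abs_of_nonneg (by linarith), abs_of_nonneg (by linarith)]
      ring
  obtain ⟨s, hs⟩ := hSL hends.1
  obtain ⟨t, ht⟩ := hSL hends.2
  rcases le_total s t with h | h
  · exact key c hc s t h hs ht
  · exact key (fun r => c (-r)) (hc.comp (IsometryEquiv.neg ℝ).isometry) (-s) (-t)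
      (neg_le_neg h) (by simpa using hs) (by simpa using ht)

theorem GeodesicConvex.sInter {F : Set (Set E)} (hF : ∀ X ∈ F, GeodesicConvex X) :
    GeodesicConvex (⋂₀ F) :=
  fun x hx y hy S hS => subset_sInter fun X hX => hF X hX x (hx X hX) y (hy X hX) S hS

/-- A segment whose endpoints are `ρ`-close to a convex set stays `ρ`-close to it. -/
theorem GeodesicConvex.exists_dist_le (hgeo : IsGeodesicSpace E) (hconv : HasConvexMetric E)
    {X : Set E} (hX : GeodesicConvex X) {x₁ x₂ y₁ y₂ w : E} {ρ : ℝ} (hx₁ : x₁ ∈ X)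
    (hx₂ : x₂ ∈ X) (h₁ : dist y₁ x₁ ≤ ρ) (h₂ : dist y₂ x₂ ≤ ρ) {S : Set E}
    (hS : IsGeodesicSegment S y₁ y₂) (hw : w ∈ S) : ∃ x ∈ X, dist w x ≤ ρ := by
  obtain ⟨T, hT⟩ := hgeo x₁ x₂
  have hTX := hX x₁ hx₁ x₂ hx₂ T hT
  obtain ⟨c, l, hc, rfl, rfl, rfl⟩ := hS
  obtain ⟨b, m, hb, rfl, rfl, rfl⟩ := hT
  obtain ⟨u, hu, rfl⟩ := hw
  obtain ⟨t, ht, rfl⟩ := hc.exists_mul_eq hu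
  refine ⟨b (t * m), hTX ⟨t * m, ⟨mul_nonneg ht.1 hb.1, mul_le_of_le_one_left hb.1 ht.2⟩, rfl⟩,
    (hconv c b l m hc hb t ht).trans ?_⟩
  nlinarith [ht.1, ht.2, mul_le_mul_of_nonneg_left h₁ (sub_nonneg.2 ht.2),
    mul_le_mul_of_nonneg_left h₂ ht.1]

theorem GeodesicConvex.infDist_le (hgeo : IsGeodesicSpace E) (hconv : HasConvexMetric E)
    {X : Set E} (hX : GeodesicConvex X) (hne : X.Nonempty) (ε : ℝ) :
    GeodesicConvex {y | infDist y X ≤ ε} := by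
  intro y₁ h₁ y₂ h₂ S hS w hw
  refine le_of_forall_pos_le_add fun (δ : ℝ) hδ => ?_
  obtain ⟨x₁, hx₁, hd₁⟩ := (infDist_lt_iff hne).1 ((show infDist y₁ X ≤ ε from h₁).trans_lt
    (lt_add_of_pos_right ε hδ))
  obtain ⟨x₂, hx₂, hd₂⟩ := (infDist_lt_iff hne).1 ((show infDist y₂ X ≤ ε from h₂).trans_lt
    (lt_add_of_pos_right ε hδ))
  obtain ⟨x, hx, hd⟩ := hX.exists_dist_le hgeo hconv hx₁ hx₂ hd₁.le hd₂.le hS hw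
  exact (infDist_le_dist_of_mem hx).trans hd

theorem HasConvexMetric.geodesicConvexFun_dist (hconv : HasConvexMetric E) (a : E) :
    GeodesicConvexFun (dist a) :=
  fun c l hc t ht => hconv (fun _ => a) c 0 l (isGeodesicPath_const a) hc t ht

theorem HasConvexMetric.geodesicConvex_petal (hconv : HasConvexMetric E) (a b : E) {α : ℝ}
    (hα : 0 ≤ α) (B : ℝ) : GeodesicConvex {y | dist a y + α * dist b y ≤ B} := by
  intro y₁ h₁ y₂ h₂ S hS w hw
  obtain ⟨c, l, hc, rfl, rfl, rfl⟩ := hS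
  obtain ⟨u, hu, rfl⟩ := hw
  obtain ⟨t, ht, rfl⟩ := hc.exists_mul_eq hu
  have ha := hconv.geodesicConvexFun_dist a c l hc t ht
  have hb := mul_le_mul_of_nonneg_left (hconv.geodesicConvexFun_dist b c l hc t ht) hα
  have h₁' := mul_le_mul_of_nonneg_left (show dist a (c 0) + α * dist b (c 0) ≤ B from h₁)
    (sub_nonneg.2 ht.2)
  have h₂' := mul_le_mul_of_nonneg_left (show dist a (c l) + α * dist b (c l) ≤ B from h₂) ht.1
  show dist a (c (t * l)) + α * dist b (c (t * l)) ≤ B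
  nlinarith

end Geodesics

section Hyperspace

variable {E : Type*} [MetricSpace E]

theorem Pbclcv.hausdorffEDist_ne_top (X Y : Pbclcv E) : hausdorffEDist X.1 Y.1 ≠ ⊤ :=
  hausdorffEDist_ne_top_of_nonempty_of_bounded X.2.1 Y.2.1 X.2.2.1 Y.2.2.1

theorem Pbclcv.exists_dist_lt {X Y : Pbclcv E} {x : E} {δ : ℝ} (h : dist X Y < δ)
    (hx : x ∈ X.1) : ∃ y ∈ Y.1, dist x y < δ :=
  exists_dist_lt_of_hausdorffDist_lt hx h (X.hausdorffEDist_ne_top Y)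

/-- The underlying closed set. -/
def Pbclcv.toCloseds (X : Pbclcv E) : TopologicalSpace.Closeds E := ⟨X.1, X.2.2.2.1⟩

theorem Pbclcv.isometry_toCloseds : Isometry (Pbclcv.toCloseds (E := E)) := by
  intro X Y
  rw [edist_dist]
  exact (ENNReal.ofReal_toReal (X.hausdorffEDist_ne_top Y)).symm

theorem Pbclcv.completeSpace [CompleteSpace E] (hgeo : IsGeodesicSpace E)
    (hconv : HasConvexMetric E) : CompleteSpace (Pbclcv E) := by
  refine Metric.complete_of_cauchySeq_tendsto fun u hu => ?_
  obtain ⟨C, hC⟩ := cauchySeq_tendsto_of_complete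
    (hu.map Pbclcv.isometry_toCloseds.uniformContinuous : CauchySeq fun n => (u n).toCloseds)
  have happrox : ∀ ε > 0, ∃ X : Pbclcv E, hausdorffEDist X.1 (C : Set E) < ENNReal.ofReal ε := by
    intro ε hε
    obtain ⟨n, hn⟩ := ((EMetric.tendsto_atTop.1 hC) (ENNReal.ofReal ε) (ENNReal.ofReal_pos.2 hε))
    exact ⟨u n, hn n le_rfl⟩
  have hmem : ∀ ε > 0, ∃ X : Pbclcv E, (∀ x ∈ X.1, ∃ y ∈ (C : Set E), dist x y < ε) ∧
      ∀ y ∈ (C : Set E), ∃ x ∈ X.1, dist y x < ε := by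
    intro ε hε
    obtain ⟨X, hX⟩ := happrox ε hε
    refine ⟨X, fun x hx => ?_, fun y hy => ?_⟩
    · obtain ⟨y, hy, h⟩ := exists_edist_lt_of_hausdorffEDist_lt hx hX
      exact ⟨y, hy, by rwa [edist_lt_ofReal] at h⟩
    · obtain ⟨x, hx, h⟩ := exists_edist_lt_of_hausdorffEDist_lt hy (hausdorffEDist_comm.trans_lt hX)
      exact ⟨x, hx, by rwa [edist_lt_ofReal] at h⟩
  obtain ⟨X, hXC, hCX⟩ := hmem 1 one_pos
  have hne : (C : Set E).Nonempty := by
    obtain ⟨x, hx⟩ := X.2.1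
    obtain ⟨y, hy, -⟩ := hXC x hx
    exact ⟨y, hy⟩
  have hbd : IsBounded (C : Set E) := by
    refine (X.2.2.1.thickening (δ := 1)).subset fun y hy => ?_
    obtain ⟨x, hx, h⟩ := hCX y hy
    exact mem_thickening_iff.2 ⟨x, hx, h⟩
  have hcv : GeodesicConvex (C : Set E) := by
    intro y₁ h₁ y₂ h₂ S hS w hw
    rw [← C.isClosed.closure_eq, Metric.mem_closure_iff]
    intro ε hε
    obtain ⟨X, hXC, hCX⟩ := hmem (ε / 2) (half_pos hε)
    obtain ⟨x₁, hx₁, hd₁⟩ := hCX y₁ h₁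
    obtain ⟨x₂, hx₂, hd₂⟩ := hCX y₂ h₂
    obtain ⟨x, hx, hd⟩ := X.2.2.2.2.exists_dist_le hgeo hconv hx₁ hx₂ hd₁.le hd₂.le hS hw
    obtain ⟨y, hy, hd'⟩ := hXC x hx
    exact ⟨y, hy, by linarith [dist_triangle w x y]⟩
  refine ⟨⟨C, hne, hbd, C.isClosed, hcv⟩, ?_⟩
  exact Pbclcv.isometry_toCloseds.isUniformInducing.isInducing.tendsto_nhds_iff.2 hC

end Hyperspace

section HyperbolicPlane

open UpperHalfPlane

/-- The point of the upper half-plane on the imaginary axis at signed distance `t` from `i`. -/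
noncomputable def axisPoint (t : ℝ) : ℍ := ⟨⟨0, Real.exp t⟩, Real.exp_pos t⟩

theorem cosh_dist_axisPoint (z : ℍ) (t : ℝ) :
    Real.cosh (dist z (axisPoint t)) =
      (z.re ^ 2 + z.im ^ 2 + Real.exp t ^ 2) / (2 * z.im * Real.exp t) := by
  rw [cosh_dist']
  have h₁ : (axisPoint t).re = 0 := rfl
  have h₂ : (axisPoint t).im = Real.exp t := rfl
  rw [h₁, h₂, sub_zero]

theorem dist_axisPoint (s t : ℝ) : dist (axisPoint s) (axisPoint t) = |s - t| := by
  have h : Real.cosh (dist (axisPoint s) (axisPoint t)) = Real.cosh (s - t) := by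
    rw [cosh_dist_axisPoint, Real.cosh_eq, neg_sub, Real.exp_sub, Real.exp_sub]
    have h₁ : (axisPoint s).re = 0 := rfl
    have h₂ : (axisPoint s).im = Real.exp s := rfl
    rw [h₁, h₂]
    have := Real.exp_pos s
    have := Real.exp_pos t
    field_simp
    ring
  rw [← abs_of_nonneg (dist_nonneg (x := axisPoint s) (y := axisPoint t))]
  exact le_antisymm (Real.cosh_le_cosh.1 h.le) (Real.cosh_le_cosh.1 h.ge)

/-- Existence of hyperbolic triangles with prescribed side lengths, one side lying on the imaginary
axis, together with Stewart's formula for the distances of the opposite vertex to this axis. -/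
theorem exists_hyperbolic_triangle {L q r : ℝ} (hL : 0 < L) (hq : 0 ≤ q) (hr : 0 ≤ r)
    (h₁ : L ≤ r + q) (h₂ : r ≤ L + q) (h₃ : q ≤ L + r) :
    ∃ z : ℍ, dist z (axisPoint 0) = r ∧ dist z (axisPoint L) = q ∧
      ∀ e, Real.cosh (dist z (axisPoint e)) = Real.cosh r * Real.exp (-e) +
        Real.sinh e * ((Real.cosh q - Real.cosh r * Real.exp (-L)) / Real.sinh L) := by
  set D := Real.cosh q - Real.cosh r * Real.exp (-L) with hD
  have hS : 0 < Real.sinh L := Real.sinh_pos_iff.2 hL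
  have hlow : D ≤ Real.sinh L * Real.exp r := by
    have h : Real.cosh q ≤ Real.cosh (L + r) := Real.cosh_le_cosh.2 (by
      rw [abs_of_nonneg hq]; exact h₃.trans (le_abs_self _))
    rw [Real.cosh_add] at h
    rw [hD, ← Real.cosh_sub_sinh, ← Real.cosh_add_sinh r]
    linarith
  have hupp : Real.sinh L * Real.exp (-r) ≤ D := by
    have h : Real.cosh (L - r) ≤ Real.cosh q := Real.cosh_le_cosh.2 (by
      rw [abs_of_nonneg hq]; exact abs_le.2 ⟨by linarith, by linarith⟩)
    rw [Real.cosh_sub] at h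
    rw [hD, ← Real.cosh_sub_sinh, ← Real.cosh_sub_sinh]
    linarith
  have hDpos : 0 < D := (mul_pos hS (Real.exp_pos _)).trans_le hupp
  set y := Real.sinh L / D with hy
  have hypos : 0 < y := div_pos hS hDpos
  have hyD : D / Real.sinh L = 1 / y := by rw [hy, one_div_div]
  have hy₁ : Real.exp (-r) ≤ y := by
    rw [hy, le_div_iff₀ hDpos, Real.exp_neg, inv_mul_le_iff₀ (Real.exp_pos r)]
    linarith
  have hy₂ : y ≤ Real.exp r := by
    rw [hy, div_le_iff₀ hDpos]
    have := mul_le_mul_of_nonneg_left hupp (Real.exp_pos r).le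
    have h : Real.exp r * Real.exp (-r) = 1 := by rw [← Real.exp_add]; simp
    nlinarith
  have hN : 0 ≤ 2 * y * Real.cosh r - 1 - y ^ 2 := by
    have h : Real.exp r * Real.exp (-r) = 1 := by rw [← Real.exp_add]; simp
    rw [Real.cosh_eq]
    nlinarith [mul_nonneg (sub_nonneg.2 hy₁) (sub_nonneg.2 hy₂)]
  let z : ℍ := ⟨⟨Real.sqrt (2 * y * Real.cosh r - 1 - y ^ 2), y⟩, hypos⟩
  have hz : ∀ e, Real.cosh (dist z (axisPoint e)) =
      Real.cosh r * Real.exp (-e) + Real.sinh e * (D / Real.sinh L) := by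
    intro e
    have hre : z.re = Real.sqrt (2 * y * Real.cosh r - 1 - y ^ 2) := rfl
    have him : z.im = y := rfl
    rw [cosh_dist_axisPoint, hre, him, Real.sq_sqrt hN, hyD, Real.sinh_eq, Real.exp_neg]
    have := Real.exp_pos e
    field_simp
    ring
  have hinj : ∀ {e s : ℝ}, 0 ≤ s → Real.cosh (dist z (axisPoint e)) = Real.cosh s →
      dist z (axisPoint e) = s := by
    intro e s hs h
    rw [← abs_of_nonneg hs, ← abs_of_nonneg (dist_nonneg (x := z) (y := axisPoint e))]
    exact le_antisymm (Real.cosh_le_cosh.1 h.le) (Real.cosh_le_cosh.1 h.ge)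
  refine ⟨z, hinj hr ?_, hinj hq ?_, hz⟩
  · rw [hz]
    simp
  · rw [hz, mul_div_cancel₀ _ hS.ne', hD]
    ring

end HyperbolicPlane

section Curvature

variable {E : Type*} [MetricSpace E]

/-- Stewart-type inequality: lower curvature bounds control the side `d(a, b)` of a triangle
`x', a, b` in terms of the two other sides and of the distance from `b` to a point of
the side `[x', a]`. -/
theorem CurvBoundedBelow.cosh_dist_le {κ : ℝ} (hκ : κ < 0) (hcurv : CurvBoundedBelow E κ)
    (hgeo : IsGeodesicSpace E) {a b x x' : E} {S : Set E} (hS : IsGeodesicSegment S x' a)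
    (hx : x ∈ S) (hxx' : 0 < dist x x') (hadd : dist a x' = dist a x + dist x x') :
    Real.cosh (√(-κ) * dist a b) ≤
      Real.cosh (√(-κ) * dist b x') * Real.exp (-(√(-κ) * dist a x')) +
        Real.sinh (√(-κ) * dist a x') * ((Real.cosh (√(-κ) * dist b x) -
          Real.cosh (√(-κ) * dist b x') * Real.exp (-(√(-κ) * dist x x'))) /
            Real.sinh (√(-κ) * dist x x')) := by
  set k := √(-κ) with hk
  have hkpos : 0 < k := Real.sqrt_pos.2 (neg_pos.2 hκ)
  have hkd : ∀ p q : UpperHalfPlane, ∀ s : ℝ, dist p q = k * s → kdist κ p q = s := by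
    intro p q s h
    rw [kdist, h, ← hk, inv_mul_cancel_left₀ hkpos.ne']
  have hLpos : 0 < dist a x' := by linarith [dist_nonneg (x := a) (y := x)]
  obtain ⟨z, hz₀, hzL, hz⟩ := exists_hyperbolic_triangle (L := k * dist a x')
    (q := k * dist a b) (r := k * dist b x') (by positivity) (by positivity) (by positivity)
    (by rw [← mul_add]; gcongr; linarith [dist_triangle a b x'])
    (by rw [← mul_add]; gcongr; linarith [dist_triangle b a x', dist_comm a b])
    (by rw [← mul_add]; gcongr; linarith [dist_triangle a x' b, dist_comm b x'])
  obtain ⟨T, hT⟩ := hgeo a b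
  obtain ⟨U, hU⟩ := hgeo x' b
  have hbU : b ∈ U := by
    obtain ⟨c, l, hc, -, rfl, rfl⟩ := hU
    exact ⟨l, ⟨hc.1, le_rfl⟩, rfl⟩
  have hcmp : kdist κ (axisPoint (k * dist x x')) z ≤ dist x b := by
    refine hcurv x' a b S T U hS hT hU (axisPoint 0) (axisPoint (k * dist a x')) z
      (hkd _ _ _ ?_) (hkd _ _ _ ?_) (hkd _ _ _ ?_) x b _ z
      (Or.inl ⟨hx, hkd _ _ _ ?_, hkd _ _ _ ?_⟩)
      (Or.inr (Or.inr ⟨hbU, hkd _ _ _ ?_, hkd _ _ _ ?_⟩))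
    · rw [dist_axisPoint, zero_sub, abs_neg, abs_of_nonneg (by positivity), dist_comm]
    · rw [dist_comm, hzL]
    · rw [dist_comm, hz₀, dist_comm]
    · rw [dist_axisPoint, zero_sub, abs_neg, abs_of_nonneg (by positivity), dist_comm]
    · rw [dist_axisPoint, abs_sub_comm, ← mul_sub, hadd, add_sub_cancel_right,
        abs_of_nonneg (by positivity), dist_comm]
    · rw [dist_comm, hz₀, dist_comm]
    · simp
  have hle : dist z (axisPoint (k * dist x x')) ≤ k * dist b x := by
    rwa [kdist, ← hk, inv_mul_le_iff₀ hkpos, dist_comm, dist_comm x b] at hcmp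
  have hcosh := Real.cosh_le_cosh.2 (abs_le_abs_of_nonneg dist_nonneg hle)
  rw [hz] at hcosh
  have hs : 0 < Real.sinh (k * dist x x') := Real.sinh_pos_iff.2 (by positivity)
  have hs' : 0 < Real.sinh (k * dist a x') := Real.sinh_pos_iff.2 (by positivity)
  rw [← sub_le_iff_le_add', ← div_le_iff₀' hs', le_div_iff₀' hs]
  linarith

/-- If the segment `[a, x]` is prolonged by `ε` to `x'`, then any `b` that is no further than `μ`
from `x` but almost at distance `μ + ε` from `x'` is close to `a`. -/
theorem CurvBoundedBelow.exists_dist_lt {κ : ℝ} (hκ : κ < 0) (hcurv : CurvBoundedBelow E κ)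
    (hgeo : IsGeodesicSpace E) {ε μ η : ℝ} (hε : 0 < ε) (hη : 0 < η) :
    ∃ τ > 0, ∀ (a b x x' : E) (S : Set E), IsGeodesicSegment S x' a → x ∈ S → dist x x' = ε →
      dist a x' = dist a x + ε → dist a x ≤ μ → dist b x ≤ μ →
      μ + ε - τ < dist a x' → μ + ε - τ < dist b x' → dist a b < η := by
  set k := √(-κ) with hk
  have hkpos : 0 < k := Real.sqrt_pos.2 (neg_pos.2 hκ)
  have hs : 0 < Real.sinh (k * ε) := Real.sinh_pos_iff.2 (by positivity)
  let Φ : ℝ × ℝ → ℝ := fun p => Real.cosh (k * p.2) * Real.exp (-(k * p.1)) +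
    Real.sinh (k * p.1) * ((Real.cosh (k * μ) - Real.cosh (k * p.2) * Real.exp (-(k * ε))) /
      Real.sinh (k * ε))
  have hΦ : Continuous Φ := by fun_prop
  have hΦ₁ : Φ (μ + ε, μ + ε) = 1 := by
    have h : (Real.cosh (k * μ) - Real.cosh (k * (μ + ε)) * Real.exp (-(k * ε))) /
        Real.sinh (k * ε) = Real.exp (-(k * (μ + ε))) := by
      rw [div_eq_iff hs.ne', Real.cosh_eq, Real.cosh_eq, Real.sinh_eq]
      have e₁ : Real.exp (k * (μ + ε)) = Real.exp (k * μ) * Real.exp (k * ε) := by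
        rw [← Real.exp_add]; ring_nf
      simp only [Real.exp_neg, e₁]
      have := Real.exp_pos (k * μ)
      have := Real.exp_pos (k * ε)
      field_simp
      ring
    show Real.cosh (k * (μ + ε)) * Real.exp (-(k * (μ + ε))) + Real.sinh (k * (μ + ε)) * _ = 1
    rw [h, ← add_mul, Real.cosh_add_sinh, ← Real.exp_add, add_neg_cancel, Real.exp_zero]
  have hlt : Φ (μ + ε, μ + ε) < Real.cosh (k * η) := by
    rw [hΦ₁]
    exact Real.one_lt_cosh.2 (by positivity)
  obtain ⟨τ, hτ, h⟩ := Metric.eventually_nhds_iff.1 (hΦ.continuousAt.eventually_lt_const hlt)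
  refine ⟨τ, hτ, fun a b x x' S hS hx hxx' hadd hax hbx hax' hbx' => ?_⟩
  have hb : dist b x' ≤ μ + ε := by linarith [dist_triangle b x x']
  have hlt' : Φ (dist a x', dist b x') < Real.cosh (k * η) := by
    refine h ?_
    rw [Prod.dist_eq, max_lt_iff, Real.dist_eq, Real.dist_eq, abs_lt, abs_lt]
    exact ⟨⟨by linarith, by linarith⟩, by linarith, by linarith⟩
  have hle := hcurv.cosh_dist_le hκ hgeo (b := b) hS hx (hxx' ▸ hε) (hxx'.symm ▸ hadd)
  rw [← hk, hxx'] at hle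
  have hmono : Real.cosh (k * dist b x) ≤ Real.cosh (k * μ) :=
    Real.cosh_le_cosh.2 (abs_le_abs_of_nonneg (by positivity) (by gcongr))
  have hs' : 0 ≤ Real.sinh (k * dist a x') := Real.sinh_nonneg_iff.2 (by positivity)
  have hcosh : Real.cosh (k * dist a b) < Real.cosh (k * η) := by
    refine (hle.trans ?_).trans_lt hlt'
    show _ ≤ Real.cosh (k * dist b x') * Real.exp (-(k * dist a x')) +
      Real.sinh (k * dist a x') * _
    gcongr
  have := Real.cosh_lt_cosh.1 hcosh
  rw [abs_of_nonneg (by positivity), abs_of_nonneg (by positivity)] at this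
  exact lt_of_mul_lt_mul_left this hkpos.le

end Curvature

section WellPosedness

variable {E : Type*} [MetricSpace E]

/-- The sets `X` for which the almost maximizing pairs of `max(A, X)`, up to a suitable threshold,
are within a distance smaller than `ε` of each other. -/
def approxMaxWellPosed (A : Set E) (ε : ℝ) : Set (Pbclcv E) :=
  {X | ∃ m, (∃ a ∈ A, ∃ x ∈ X.1, m < dist a x) ∧ ∃ r < ε,
    ∀ a ∈ A, ∀ a' ∈ A, ∀ x ∈ X.1, ∀ x' ∈ X.1, m < dist a x → m < dist a' x' →
      dist a a' ≤ r ∧ dist x x' ≤ r}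

theorem isOpen_approxMaxWellPosed (A : Set E) (ε : ℝ) : IsOpen (approxMaxWellPosed A ε) := by
  rw [Metric.isOpen_iff]
  rintro X ⟨m, ⟨a₀, ha₀, x₀, hx₀, h₀⟩, r, hr, h⟩
  obtain ⟨δ, hδ, hδ₁, hδ₂⟩ : ∃ δ > 0, 2 * δ < dist a₀ x₀ - m ∧ 2 * δ < ε - r :=
    ⟨min (dist a₀ x₀ - m) (ε - r) / 3,
      div_pos (lt_min (sub_pos.2 h₀) (sub_pos.2 hr)) three_pos,
      by linarith [min_le_left (dist a₀ x₀ - m) (ε - r), lt_min (sub_pos.2 h₀) (sub_pos.2 hr)],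
      by linarith [min_le_right (dist a₀ x₀ - m) (ε - r), lt_min (sub_pos.2 h₀) (sub_pos.2 hr)]⟩
  refine ⟨δ, hδ, fun Y hY => ?_⟩
  rw [mem_ball] at hY
  refine ⟨m + δ, ?_, r + 2 * δ, by linarith, ?_⟩
  · obtain ⟨y, hy, hxy⟩ := Pbclcv.exists_dist_lt ((dist_comm X Y).trans_lt hY) hx₀
    exact ⟨a₀, ha₀, y, hy, by linarith [dist_triangle a₀ y x₀, dist_comm x₀ y]⟩
  · intro a ha a' ha' y hy y' hy' hay hay'
    obtain ⟨x, hx, hxy⟩ := Pbclcv.exists_dist_lt hY hy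
    obtain ⟨x', hx', hxy'⟩ := Pbclcv.exists_dist_lt hY hy'
    obtain ⟨h₁, h₂⟩ := h a ha a' ha' x hx x' hx'
      (by linarith [dist_triangle a x y, dist_comm x y])
      (by linarith [dist_triangle a' x' y', dist_comm x' y'])
    exact ⟨by linarith, by linarith [dist_triangle4 y x x' y', dist_comm x' y']⟩

theorem bddAbove_image2_dist {A X : Set E} (hA : IsBounded A) (hX : IsBounded X) :
    BddAbove (image2 dist A X) := by
  obtain ⟨C, hC⟩ := Metric.isBounded_iff.1 (hA.union hX)
  refine ⟨C, ?_⟩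
  rintro _ ⟨a, ha, x, hx, rfl⟩
  exact hC (Or.inl ha) (Or.inr hx)

theorem dist_le_supSetDist {A X : Set E} (hA : IsBounded A) (hX : IsBounded X) {a x : E}
    (ha : a ∈ A) (hx : x ∈ X) : dist a x ≤ supSetDist A X :=
  le_csSup (bddAbove_image2_dist hA hX) (mem_image2_of_mem ha hx)

theorem MaxWellPosed.mem_approxMaxWellPosed {A : Set E} (hA : IsBounded A) {X : Pbclcv E}
    (h : MaxWellPosed A X.1) {ε : ℝ} (hε : 0 < ε) : X ∈ approxMaxWellPosed A ε := by
  obtain ⟨a₀, ha₀, x₀, hx₀, h₀, -, hseq⟩ := h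
  obtain ⟨m, hm, hclose⟩ : ∃ m < supSetDist A X.1, ∀ a ∈ A, ∀ x ∈ X.1, m < dist a x →
      dist x x₀ < ε / 4 ∧ dist a a₀ < ε / 4 := by
    by_contra! hcon
    have hstep : ∀ n : ℕ, ∃ a ∈ A, ∃ x ∈ X.1, supSetDist A X.1 - 1 / (n + 1 : ℝ) < dist a x ∧
        (dist x x₀ < ε / 4 → ε / 4 ≤ dist a a₀) := fun n =>
      hcon _ (sub_lt_self _ (by positivity))
    choose a ha x hx hax hfar using hstep
    have hlim : Tendsto (fun n => dist (a n) (x n)) atTop (nhds (supSetDist A X.1)) := by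
      refine tendsto_of_tendsto_of_tendsto_of_le_of_le ?_ tendsto_const_nhds
        (fun n => (hax n).le) fun n => dist_le_supSetDist hA X.2.2.1 (ha n) (hx n)
      simpa using tendsto_const_nhds.sub (tendsto_one_div_add_atTop_nhds_zero_nat (𝕜 := ℝ))
    obtain ⟨hta, htx⟩ := hseq a x ha hx hlim
    obtain ⟨n, hn₁, hn₂⟩ := ((Metric.tendsto_nhds.1 hta (ε / 4) (by positivity)).and
      (Metric.tendsto_nhds.1 htx (ε / 4) (by positivity))).exists
    exact (hfar n hn₂).not_gt hn₁
  refine ⟨m, ⟨a₀, ha₀, x₀, hx₀, h₀ ▸ hm⟩, ε / 2, half_lt_self hε, ?_⟩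
  intro a ha a' ha' x hx x' hx' hax hax'
  obtain ⟨h₁, h₂⟩ := hclose a ha x hx hax
  obtain ⟨h₃, h₄⟩ := hclose a' ha' x' hx' hax'
  exact ⟨by linarith [dist_triangle_right a a' a₀], by linarith [dist_triangle_right x x' x₀]⟩

theorem maxWellPosed_of_forall_mem [CompleteSpace E] {A : Set E} (hA : A.Nonempty)
    (hAb : IsBounded A) (hAc : IsClosed A) {X : Pbclcv E}
    (h : ∀ ε > 0, X ∈ approxMaxWellPosed A ε) : MaxWellPosed A X.1 := by
  have hcauchy : ∀ ε > 0, ∃ m < supSetDist A X.1, ∀ a ∈ A, ∀ a' ∈ A, ∀ x ∈ X.1, ∀ x' ∈ X.1,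
      m < dist a x → m < dist a' x' → dist a a' < ε ∧ dist x x' < ε := by
    intro ε hε
    obtain ⟨m, ⟨a, ha, x, hx, hm⟩, r, hr, hclose⟩ := h ε hε
    refine ⟨m, hm.trans_le (dist_le_supSetDist hAb X.2.2.1 ha hx), ?_⟩
    intro a ha a' ha' x hx x' hx' hax hax'
    obtain ⟨h₁, h₂⟩ := hclose a ha a' ha' x hx x' hx' hax hax'
    exact ⟨h₁.trans_lt hr, h₂.trans_lt hr⟩
  obtain ⟨u, -, hu, hmem⟩ := exists_seq_tendsto_sSup (hA.image2 X.2.1)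
    (bddAbove_image2_dist hAb X.2.2.1)
  choose a ha x hx hax using hmem
  have hlim : Tendsto (fun n => dist (a n) (x n)) atTop (nhds (supSetDist A X.1)) := by
    simpa only [hax, supSetDist] using hu
  have hseq : ∀ ε > 0, ∃ N, ∀ m ≥ N, ∀ n ≥ N,
      dist (a m) (a n) < ε ∧ dist (x m) (x n) < ε := by
    intro ε hε
    obtain ⟨m, hm, hclose⟩ := hcauchy ε hε
    obtain ⟨N, hN⟩ := eventually_atTop.1 (hlim.eventually_const_lt hm)
    exact ⟨N, fun i hi j hj => hclose _ (ha i) _ (ha j) _ (hx i) _ (hx j) (hN i hi) (hN j hj)⟩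
  obtain ⟨a₀, ha₀⟩ := cauchySeq_tendsto_of_complete (u := a) (Metric.cauchySeq_iff.2
    fun ε hε => (hseq ε hε).imp fun N hN i hi j hj => (hN i hi j hj).1)
  obtain ⟨x₀, hx₀⟩ := cauchySeq_tendsto_of_complete (u := x) (Metric.cauchySeq_iff.2
    fun ε hε => (hseq ε hε).imp fun N hN i hi j hj => (hN i hi j hj).2)
  have ha₀A : a₀ ∈ A := hAc.mem_of_tendsto ha₀ (Eventually.of_forall ha)
  have hx₀X : x₀ ∈ X.1 := X.2.2.2.1.mem_of_tendsto hx₀ (Eventually.of_forall hx)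
  have h₀ : dist a₀ x₀ = supSetDist A X.1 := tendsto_nhds_unique (ha₀.dist hx₀) hlim
  refine ⟨a₀, ha₀A, x₀, hx₀X, h₀, fun b hb y hy hby => ?_, fun b y hb hy hby => ?_⟩
  · have hzero : ∀ ε > 0, dist b a₀ < ε ∧ dist y x₀ < ε := by
      intro ε hε
      obtain ⟨m, hm, hclose⟩ := hcauchy ε hε
      exact hclose b hb a₀ ha₀A y hy x₀ hx₀X (hby ▸ hm) (h₀ ▸ hm)
    exact ⟨dist_le_zero.1 (le_of_forall_pos_lt_add fun ε hε => by simpa using (hzero ε hε).1),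
      dist_le_zero.1 (le_of_forall_pos_lt_add fun ε hε => by simpa using (hzero ε hε).2)⟩
  · have hev : ∀ ε > 0, ∀ᶠ n in atTop, dist (b n) a₀ < ε ∧ dist (y n) x₀ < ε := by
      intro ε hε
      obtain ⟨m, hm, hclose⟩ := hcauchy ε hε
      filter_upwards [hby.eventually_const_lt hm] with n hn
      exact hclose _ (hb n) a₀ ha₀A _ (hy n) x₀ hx₀X hn (h₀ ▸ hm)
    exact ⟨Metric.tendsto_nhds.2 fun ε hε => (hev ε hε).mono fun n hn => hn.1,
      Metric.tendsto_nhds.2 fun ε hε => (hev ε hε).mono fun n hn => hn.2⟩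

theorem setOf_maxWellPosed_eq_iInter [CompleteSpace E] {A : Set E} (hA : A.Nonempty)
    (hAb : IsBounded A) (hAc : IsClosed A) :
    {X : Pbclcv E | MaxWellPosed A X.1} = ⋂ n : ℕ, approxMaxWellPosed A (1 / (n + 1 : ℝ)) := by
  ext X
  refine ⟨fun h => mem_iInter.2 fun n => MaxWellPosed.mem_approxMaxWellPosed hAb h (by positivity),
    fun h => maxWellPosed_of_forall_mem hA hAb hAc fun ε hε => ?_⟩
  obtain ⟨n, hn⟩ := exists_nat_one_div_lt hε
  obtain ⟨m, hm, r, hr, hclose⟩ := mem_iInter.1 h n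
  exact ⟨m, hm, r, hr.trans hn, hclose⟩

/-- The closed convex hull of `X ∪ {p}`, as an element of the hyperspace. It lies within the
distance from `p` to a point of `X`, and in every closed convex set containing `X ∪ {p}`. -/
theorem Pbclcv.exists_hull_insert (hgeo : IsGeodesicSpace E) (hconv : HasConvexMetric E)
    (X : Pbclcv E) {x p : E} (hx : x ∈ X.1) :
    ∃ Y : Pbclcv E, p ∈ Y.1 ∧ dist Y X ≤ dist p x ∧
      ∀ C : Set E, IsClosed C → GeodesicConvex C → X.1 ⊆ C → p ∈ C → Y.1 ⊆ C := by
  let F : Set (Set E) := {C | IsClosed C ∧ GeodesicConvex C ∧ X.1 ⊆ C ∧ p ∈ C}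
  have hmin : ∀ C : Set E, IsClosed C → GeodesicConvex C → X.1 ⊆ C → p ∈ C → ⋂₀ F ⊆ C :=
    fun C h₁ h₂ h₃ h₄ => sInter_subset_of_mem ⟨h₁, h₂, h₃, h₄⟩
  have hp : p ∈ ⋂₀ F := fun C hC => hC.2.2.2
  have hXF : X.1 ⊆ ⋂₀ F := subset_sInter fun C hC => hC.2.2.1
  have hnear : ⋂₀ F ⊆ {y | infDist y X.1 ≤ dist p x} :=
    hmin _ (isClosed_le (continuous_infDist_pt _) continuous_const)
      (X.2.2.2.2.infDist_le hgeo hconv X.2.1 _)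
      (fun y hy => (infDist_zero_of_mem hy).trans_le dist_nonneg) (infDist_le_dist_of_mem hx)
  have hbd : IsBounded (⋂₀ F) := by
    refine (X.2.2.1.thickening (δ := dist p x + 1)).subset fun y hy => ?_
    obtain ⟨z, hz, h⟩ := (infDist_lt_iff X.2.1).1 ((hnear hy).trans_lt (lt_add_one _))
    exact mem_thickening_iff.2 ⟨z, hz, h⟩
  refine ⟨⟨⋂₀ F, ⟨p, hp⟩, hbd, isClosed_sInter fun C hC => hC.1,
    GeodesicConvex.sInter fun C hC => hC.2.1⟩, hp, ?_, hmin⟩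
  exact hausdorffDist_le_of_infDist dist_nonneg hnear
    fun y hy => (infDist_zero_of_mem (hXF hy)).trans_le dist_nonneg

theorem dense_approxMaxWellPosed (hgeo : IsGeodesicSpace E) (hconv : HasConvexMetric E)
    (hext : GeodesicExtensionProperty E) {κ : ℝ} (hκ : κ < 0) (hcurv : CurvBoundedBelow E κ)
    {A : Set E} (hA : A.Nonempty) (hAb : IsBounded A) {η : ℝ} (hη : 0 < η) :
    Dense (approxMaxWellPosed A η) := by
  refine Metric.dense_iff.2 fun X ρ hρ => ?_
  set ε := ρ / 2 with hε_def
  have hε : 0 < ε := half_pos hρ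
  set μ := supSetDist A X.1 with hμ
  have hle : ∀ a ∈ A, ∀ x ∈ X.1, dist a x ≤ μ := fun a ha x hx =>
    dist_le_supSetDist hAb X.2.2.1 ha hx
  obtain ⟨τ, hτ, hclose⟩ := hcurv.exists_dist_lt hκ hgeo (μ := μ) hε (η := η / 4) (by positivity)
  set D := diam X.1 + ε with hD_def
  have hD : 0 < D := add_pos_of_nonneg_of_pos diam_nonneg hε
  set α := ε / D with hα_def
  have hα : 0 < α := div_pos hε hD
  obtain ⟨σ, hσ, hσ₁, hσ₂⟩ : ∃ σ > 0, σ < α * (η / 4) ∧ σ + σ / α < τ := by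
    have hpos : 0 < min (α * (η / 4)) (τ / (1 + 1 / α)) := by positivity
    refine ⟨_, half_pos hpos, (half_lt_self hpos).trans_le (min_le_left _ _), ?_⟩
    have := (half_lt_self hpos).trans_le (min_le_right _ _)
    rw [lt_div_iff₀ (by positivity)] at this
    exact (by ring : _ = _).trans_lt this
  obtain ⟨_, ⟨a, ha, x, hx, rfl⟩, hax⟩ := exists_lt_of_lt_csSup (hA.image2 X.2.1)
    (show μ - σ < sSup (image2 dist A X.1) from sub_lt_self μ hσ)
  obtain ⟨p, S, hS, hxS, hxp, hap⟩ := hext.exists_prolongation hgeo a x hε.le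
  obtain ⟨Y, hpY, hYX, hYmin⟩ := X.exists_hull_insert hgeo hconv (p := p) hx
  have hpetal : ∀ b ∈ A, ∀ y ∈ Y.1, dist b y + α * dist p y ≤ μ + ε := by
    intro b hb
    refine hYmin {y | dist b y + α * dist p y ≤ μ + ε}
      (isClosed_le (by fun_prop) continuous_const) (hconv.geodesicConvex_petal b p hα.le _)
      (fun z hz => ?_) ?_
    · have h : dist p z ≤ D := by
        linarith [dist_triangle p x z, dist_comm x p, dist_le_diam_of_mem X.2.2.1 hx hz]
      have h' : α * dist p z ≤ ε := by
        calc α * dist p z ≤ α * D := by gcongr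
          _ = ε := div_mul_cancel₀ ε hD.ne'
      exact add_le_add (hle b hb z hz) h'
    · show dist b p + α * dist p p ≤ μ + ε
      rw [dist_self, mul_zero, add_zero]
      linarith [dist_triangle b x p, hle b hb x hx]
  have hnear : ∀ b ∈ A, ∀ y ∈ Y.1, μ + ε - σ < dist b y →
      dist a b < η / 4 ∧ dist p y < η / 4 := by
    intro b hb y hy hby
    have h₁ : dist p y < σ / α := by
      rw [lt_div_iff₀' hα]
      linarith [hpetal b hb y hy]
    refine ⟨hclose a b x p S hS hxS hxp hap (hle a ha x hx) (hle b hb x hx) ?_ ?_, h₁.trans ?_⟩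
    · linarith [div_pos hσ hα]
    · linarith [dist_triangle b p y]
    · rwa [div_lt_iff₀' hα]
  refine ⟨Y, ?_, μ + ε - σ, ⟨a, ha, p, hpY, by linarith⟩, η / 2, half_lt_self hη, ?_⟩
  · rw [mem_ball]
    exact hYX.trans_lt (by rw [dist_comm, hxp]; exact half_lt_self hρ)
  · intro b hb b' hb' y hy y' hy' hby hby'
    obtain ⟨h₁, h₂⟩ := hnear b hb y hy hby
    obtain ⟨h₃, h₄⟩ := hnear b' hb' y' hy' hby'
    exact ⟨by linarith [dist_triangle_left b b' a], by linarith [dist_triangle_left y y' p]⟩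

end WellPosedness

/-- in a complete geodesic space with convex metric, the geodesic
extension property and curvature bounded below, the family of sets for which
`max(A,X)` is well-posed is a dense `G_δ`-set in `P_{b,cl,cv}(E)`. -/
theorem statement6 {E : Type*} [MetricSpace E] [CompleteSpace E]
    (hgeo : IsGeodesicSpace E) (hconv : HasConvexMetric E)
    (hext : GeodesicExtensionProperty E)
    (κ : ℝ) (hκ : κ < 0) (hcurv : CurvBoundedBelow E κ)
    (A : Set E) (hA : A.Nonempty) (hAb : IsBounded A) (hAc : IsClosed A) :
    Dense {X : Pbclcv E | MaxWellPosed A X.1} ∧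
    IsGδ {X : Pbclcv E | MaxWellPosed A X.1} := by
  have := Pbclcv.completeSpace hgeo hconv
  rw [setOf_maxWellPosed_eq_iInter hA hAb hAc]
  have hopen : ∀ n : ℕ, IsOpen (approxMaxWellPosed A (1 / (n + 1 : ℝ))) :=
    fun n => isOpen_approxMaxWellPosed A _
  exact ⟨dense_iInter_of_isOpen_nat hopen fun n =>
    dense_approxMaxWellPosed hgeo hconv hext hκ hcurv hA hAb (by positivity),
    IsGδ.iInter_of_isOpen hopen⟩
end

section
/- Let E be a complete CAT(0) space, let X be a nonempty, bounded, closed and convex subset of E and let Y be a nonempty, bounded and closed subset of E. Then the minimization problem min(X,Y) is well-posed if and only if inf_{σ>0} diam L_{YX}(σ) = 0. -/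
open Metric Set Filter Bornology

theorem exists_comparison_triangle {a b e : ℝ} (ha : 0 < a)
    (h₁ : a ≤ e + b) (h₂ : e ≤ a + b) (h₃ : b ≤ a + e) :
    ∃ u v : ℝ, u ^ 2 + v ^ 2 = e ^ 2 ∧ (u - a) ^ 2 + v ^ 2 = b ^ 2 := by
  have hu : 2 * a * ((e ^ 2 + a ^ 2 - b ^ 2) / (2 * a)) = e ^ 2 + a ^ 2 - b ^ 2 := by
    field_simp
  set u := (e ^ 2 + a ^ 2 - b ^ 2) / (2 * a)
  have hue : u ≤ e := by
    refine le_of_mul_le_mul_left (a := 2 * a) ?_ (by positivity)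
    nlinarith [mul_nonneg (sub_nonneg.2 h₁) (sub_nonneg.2 h₂)]
  have heu : -e ≤ u := by
    refine le_of_mul_le_mul_left (a := 2 * a) ?_ (by positivity)
    nlinarith
  have hv : Real.sqrt (e ^ 2 - u ^ 2) ^ 2 = e ^ 2 - u ^ 2 :=
    Real.sq_sqrt (by nlinarith)
  exact ⟨u, Real.sqrt (e ^ 2 - u ^ 2), by linarith, by nlinarith⟩

theorem EuclideanSpace.dist_vec_two_eq {a b c d r : ℝ} (hr : 0 ≤ r)
    (h : (a - c) ^ 2 + (b - d) ^ 2 = r ^ 2) :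
    dist (!₂[a, b] : EuclideanSpace ℝ (Fin 2)) !₂[c, d] = r := by
  rw [EuclideanSpace.dist_eq]
  simp [Fin.sum_univ_two, Real.dist_eq, sq_abs, h, Real.sqrt_sq hr]

/-- The Bruhat–Tits (CN) inequality, for some point of a geodesically convex set. -/
theorem CATZero.exists_midpoint_mem {E : Type*} [MetricSpace E] (hcat : CATZero E)
    {X : Set E} (hXcv : GeodesicConvex X) {x x' : E} (hx : x ∈ X) (hx' : x' ∈ X) (y : E) :
    ∃ m ∈ X, dist m y ^ 2 ≤ dist x y ^ 2 / 2 + dist x' y ^ 2 / 2 - dist x x' ^ 2 / 4 := by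
  rcases eq_or_ne x x' with rfl | hne
  · exact ⟨x, hx, by simp⟩
  have ha : 0 < dist x x' := dist_pos.2 hne
  obtain ⟨S, hS⟩ := hcat.1 x x'
  obtain ⟨T, hT⟩ := hcat.1 x' y
  obtain ⟨U, hU⟩ := hcat.1 x y
  have hyT : y ∈ T := by
    obtain ⟨c, l, hc, -, rfl, rfl⟩ := hT
    exact ⟨l, ⟨hc.1, le_rfl⟩, rfl⟩
  obtain ⟨m, hmS, hm₁, hm₂⟩ : ∃ m ∈ S, dist x m = dist x x' / 2 ∧ dist m x' = dist x x' / 2 := by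
    obtain ⟨c, l, ⟨hl, hc⟩, rfl, rfl, rfl⟩ := hS
    have h0 : (0 : ℝ) ∈ Icc 0 l := ⟨le_rfl, hl⟩
    have h1 : l ∈ Icc 0 l := ⟨hl, le_rfl⟩
    have h2 : l / 2 ∈ Icc 0 l := ⟨by linarith, by linarith⟩
    refine ⟨c (l / 2), ⟨_, h2, rfl⟩, ?_, ?_⟩
    · rw [hc _ h0 _ h2, hc _ h0 _ h1, zero_sub, zero_sub, abs_neg, abs_neg, abs_of_nonneg hl,
        abs_of_nonneg h2.1]
    · rw [hc _ h2 _ h1, hc _ h0 _ h1, zero_sub, abs_neg, abs_of_nonneg hl, abs_sub_comm,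
        abs_of_nonneg (by linarith)]
      ring
  refine ⟨m, hXcv x hx x' hx' S hS hmS, ?_⟩
  obtain ⟨u, v, huv, huv'⟩ := exists_comparison_triangle (e := dist x y) (b := dist x' y) ha
    (dist_triangle_right _ _ _) (dist_triangle _ _ _)
    (dist_triangle_left _ _ _)
  have h₁₂ : dist (!₂[0, 0] : EuclideanSpace ℝ (Fin 2)) !₂[dist x x', 0] = dist x x' :=
    EuclideanSpace.dist_vec_two_eq dist_nonneg (by ring)
  have h₂₃ : dist (!₂[dist x x', 0] : EuclideanSpace ℝ (Fin 2)) !₂[u, v] = dist x' y :=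
    EuclideanSpace.dist_vec_two_eq dist_nonneg (by linarith)
  have h₁₃ : dist (!₂[0, 0] : EuclideanSpace ℝ (Fin 2)) !₂[u, v] = dist x y :=
    EuclideanSpace.dist_vec_two_eq dist_nonneg (by linarith)
  have key := hcat.2 x x' y S T U hS hT hU _ _ _ h₁₂ h₂₃ h₁₃ m y !₂[dist x x' / 2, 0] !₂[u, v]
    (Or.inl ⟨hmS,
      (EuclideanSpace.dist_vec_two_eq (by positivity) (by ring)).trans hm₁.symm,
      (EuclideanSpace.dist_vec_two_eq (by positivity) (by ring)).trans hm₂.symm⟩)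
    (Or.inr (Or.inl ⟨hyT, h₂₃, by simp⟩))
  rw [EuclideanSpace.dist_eq !₂[dist x x' / 2, 0]] at key
  simp only [Fin.sum_univ_two, Real.dist_eq, sq_abs] at key
  have hsq := (Real.le_sqrt dist_nonneg (by positivity)).1 key
  simp only [Matrix.cons_val_zero, Matrix.cons_val_one] at hsq
  nlinarith

/-- In a CAT(0) space, two almost nearest points of a convex set are close to each other. -/
theorem CATZero.sq_dist_le {E : Type*} [MetricSpace E] (hcat : CATZero E)
    {X : Set E} (hXcv : GeodesicConvex X) {x x' : E} (hx : x ∈ X) (hx' : x' ∈ X) (y : E) :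
    dist x x' ^ 2 ≤
      2 * (dist x y ^ 2 - infDist y X ^ 2) + 2 * (dist x' y ^ 2 - infDist y X ^ 2) := by
  obtain ⟨m, hm, h⟩ := hcat.exists_midpoint_mem hXcv hx hx' y
  have h₁ : infDist y X ≤ dist m y := dist_comm y m ▸ infDist_le_dist_of_mem hm
  have h₂ : infDist y X ^ 2 ≤ dist m y ^ 2 := by
    gcongr
    exact infDist_nonneg
  linarith

/-- In a CAT(0) space, a sequence in a convex set minimizing the distance to a point is
Cauchy. -/
theorem CATZero.cauchySeq_of_tendsto_infDist {E : Type*} [MetricSpace E] (hcat : CATZero E)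
    {X : Set E} (hXcv : GeodesicConvex X) {y : E} {x : ℕ → E} (hx : ∀ n, x n ∈ X)
    (h : Tendsto (fun n => dist (x n) y) atTop (nhds (infDist y X))) : CauchySeq x := by
  rw [Metric.cauchySeq_iff]
  intro ε hε
  have h' : Tendsto (fun n => 2 * (dist (x n) y ^ 2 - infDist y X ^ 2)) atTop
      (nhds (2 * (infDist y X ^ 2 - infDist y X ^ 2))) :=
    ((h.pow 2).sub_const _).const_mul 2
  rw [sub_self, mul_zero] at h'
  obtain ⟨N, hN⟩ := eventually_atTop.1 (h'.eventually_lt_const (by positivity : 0 < ε ^ 2 / 2))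
  refine ⟨N, fun m hm n hn => lt_of_pow_lt_pow_left₀ 2 hε.le ?_⟩
  linarith [hcat.sq_dist_le hXcv (hx m) (hx n) y, hN m hm, hN n hn]

theorem CATZero.exists_nearest {E : Type*} [MetricSpace E] [CompleteSpace E] (hcat : CATZero E)
    {X : Set E} (hX : X.Nonempty) (hXc : IsClosed X) (hXcv : GeodesicConvex X) (y : E) :
    ∃ x ∈ X, dist x y = infDist y X := by
  have hx : ∀ n : ℕ, ∃ x ∈ X, dist y x < infDist y X + 1 / (n + 1) := fun n =>
    (infDist_lt_iff hX).1 (lt_add_of_pos_right _ Nat.one_div_pos_of_nat)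
  choose x hx hxy using hx
  have h : Tendsto (fun n => dist (x n) y) atTop (nhds (infDist y X)) := by
    refine tendsto_of_tendsto_of_tendsto_of_le_of_le tendsto_const_nhds
      (h := fun n : ℕ => infDist y X + 1 / ((n : ℝ) + 1)) ?_ (fun n => ?_) (fun n => ?_)
    · simpa using tendsto_one_div_add_atTop_nhds_zero_nat.const_add (infDist y X)
    · exact dist_comm y (x n) ▸ infDist_le_dist_of_mem (hx n)
    · exact dist_comm y (x n) ▸ (hxy n).le
  obtain ⟨x₀, h₀⟩ := cauchySeq_tendsto_of_complete (hcat.cauchySeq_of_tendsto_infDist hXcv hx h)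
  exact ⟨x₀, hXc.mem_of_tendsto h₀ (Eventually.of_forall hx),
    tendsto_nhds_unique (h₀.dist tendsto_const_nhds) h⟩

theorem infSetDist_comm {E : Type*} [MetricSpace E] (X Y : Set E) :
    infSetDist X Y = infSetDist Y X := by
  simp only [infSetDist]
  rw [Set.image2_swap]
  simp only [dist_comm]

theorem infSetDist_le_dist {E : Type*} [MetricSpace E] {X Y : Set E} {x y : E}
    (hx : x ∈ X) (hy : y ∈ Y) : infSetDist X Y ≤ dist x y := by
  refine csInf_le ⟨0, ?_⟩ (mem_image2_of_mem hx hy)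
  rintro _ ⟨a, -, b, -, rfl⟩
  exact dist_nonneg

theorem infSetDist_le_infDist {E : Type*} [MetricSpace E] {X Y : Set E} {y : E}
    (hX : X.Nonempty) (hy : y ∈ Y) : infSetDist X Y ≤ infDist y X :=
  (le_infDist hX).2 fun x hx => dist_comm x y ▸ infSetDist_le_dist hx hy

theorem exists_dist_lt_infSetDist_add {E : Type*} [MetricSpace E] {X Y : Set E}
    (hX : X.Nonempty) (hY : Y.Nonempty) {σ : ℝ} (hσ : 0 < σ) :
    ∃ x ∈ X, ∃ y ∈ Y, dist x y < infSetDist X Y + σ := by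
  obtain ⟨_, ⟨x, hx, y, hy, rfl⟩, h⟩ := Real.lt_sInf_add_pos (hX.image2 hY (f := dist)) hσ
  exact ⟨x, hx, y, hy, h⟩

theorem mem_Lset_of_dist_le {E : Type*} [MetricSpace E] {X Y : Set E} {x y : E} {σ : ℝ}
    (hx : x ∈ X) (hy : y ∈ Y) (h : dist x y ≤ infSetDist X Y + σ) : y ∈ Lset Y X σ :=
  ⟨hy, (infDist_le_dist_of_mem hx).trans <| by rwa [dist_comm, infSetDist_comm]⟩

theorem zero_mem_lowerBounds_diam_Lset {E : Type*} [MetricSpace E] (X Y : Set E) :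
    0 ∈ lowerBounds ((fun σ => diam (Lset Y X σ)) '' Ioi 0) := by
  rintro _ ⟨σ, -, rfl⟩
  exact diam_nonneg

/-- If every `L_{YX}(σ)` contained points far from `y₀`, there would be a minimizing sequence
that does not converge. -/
theorem MinWellPosed.sInf_diam_Lset {E : Type*} [MetricSpace E] {X Y : Set E}
    (hX : X.Nonempty) (h : MinWellPosed X Y) :
    sInf ((fun σ => diam (Lset Y X σ)) '' Ioi 0) = 0 := by
  obtain ⟨x₀, -, y₀, -, -, -, hlim⟩ := h
  refine le_antisymm (le_of_forall_pos_le_add fun ε hε => ?_)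
    (le_csInf (nonempty_Ioi.image _) (zero_mem_lowerBounds_diam_Lset X Y))
  rw [zero_add]
  suffices ∃ σ > 0, Lset Y X σ ⊆ closedBall y₀ (ε / 2) by
    obtain ⟨σ, hσ, hsub⟩ := this
    refine (csInf_le ⟨0, zero_mem_lowerBounds_diam_Lset X Y⟩ ⟨σ, hσ, rfl⟩).trans ?_
    refine (diam_mono hsub isBounded_closedBall).trans ?_
    exact (diam_closedBall (by positivity)).trans_eq (by ring)
  by_contra! hcon
  have hxy : ∀ n : ℕ, ∃ x ∈ X, ∃ y ∈ Y, ε / 2 < dist y y₀ ∧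
      dist x y < infSetDist X Y + 2 * (1 / (n + 1)) := by
    intro n
    have hn : (0 : ℝ) < 1 / (n + 1) := Nat.one_div_pos_of_nat
    obtain ⟨y, ⟨hy, hyX⟩, hyb⟩ := not_subset.1 (hcon _ hn)
    obtain ⟨x, hx, hlt⟩ := (infDist_lt_iff hX).1 (lt_add_of_pos_right (infDist y X) hn)
    rw [infSetDist_comm] at hyX
    rw [dist_comm] at hlt
    exact ⟨x, hx, y, hy, not_le.1 hyb, by linarith⟩
  choose x hx y hy hfar hlt using hxy
  have hd : Tendsto (fun n => dist (x n) (y n)) atTop (nhds (infSetDist X Y)) := by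
    refine tendsto_of_tendsto_of_tendsto_of_le_of_le tendsto_const_nhds
      (h := fun n : ℕ => infSetDist X Y + 2 * (1 / ((n : ℝ) + 1))) ?_
      (fun n => infSetDist_le_dist (hx n) (hy n)) (fun n => (hlt n).le)
    simpa using (tendsto_one_div_add_atTop_nhds_zero_nat.const_mul 2).const_add (infSetDist X Y)
  have hy₀ := (tendsto_iff_dist_tendsto_zero.1 (hlim x y hx hy hd).2).eventually_lt_const
    (half_pos hε)
  obtain ⟨n, hn⟩ := hy₀.exists
  exact lt_asymm hn (hfar n)

theorem exists_diam_Lset_lt {E : Type*} [MetricSpace E] {X Y : Set E}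
    (h : sInf ((fun σ => diam (Lset Y X σ)) '' Ioi 0) = 0) {ε : ℝ} (hε : 0 < ε) :
    ∃ σ > 0, diam (Lset Y X σ) < ε := by
  obtain ⟨_, ⟨σ, hσ, rfl⟩, hlt⟩ := exists_lt_of_csInf_lt (nonempty_Ioi.image _) (h.trans_lt hε)
  exact ⟨σ, hσ, hlt⟩

/-- If the diameters of the sets `L_{YX}(σ)` are arbitrarily small, then any sequence which
eventually lies in each of them is Cauchy. -/
theorem cauchySeq_of_eventually_mem_Lset {E : Type*} [MetricSpace E] {X Y : Set E}
    (hYb : IsBounded Y) (h : sInf ((fun σ => diam (Lset Y X σ)) '' Ioi 0) = 0) {y : ℕ → E}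
    (hy : ∀ σ > 0, ∀ᶠ n in atTop, y n ∈ Lset Y X σ) : CauchySeq y := by
  rw [Metric.cauchySeq_iff]
  intro ε hε
  obtain ⟨σ, hσ, hlt⟩ := exists_diam_Lset_lt h hε
  obtain ⟨N, hN⟩ := eventually_atTop.1 (hy σ hσ)
  exact ⟨N, fun m hm n hn =>
    (dist_le_diam_of_mem (hYb.subset (sep_subset _ _)) (hN m hm) (hN n hn)).trans_lt hlt⟩

theorem eventually_mem_Lset {E : Type*} [MetricSpace E] {X Y : Set E} {x y : ℕ → E}
    (hx : ∀ n, x n ∈ X) (hy : ∀ n, y n ∈ Y)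
    (hd : Tendsto (fun n => dist (x n) (y n)) atTop (nhds (infSetDist X Y))) :
    ∀ σ > 0, ∀ᶠ n in atTop, y n ∈ Lset Y X σ := fun _ hσ =>
  (hd.eventually_le_const (lt_add_of_pos_right _ hσ)).mono fun n hn =>
    mem_Lset_of_dist_le (hx n) (hy n) hn

theorem exists_tendsto_infSetDist {E : Type*} [MetricSpace E] {X Y : Set E}
    (hX : X.Nonempty) (hY : Y.Nonempty) :
    ∃ x y : ℕ → E, (∀ n, x n ∈ X) ∧ (∀ n, y n ∈ Y) ∧
      Tendsto (fun n => dist (x n) (y n)) atTop (nhds (infSetDist X Y)) := by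
  have hxy : ∀ n : ℕ, ∃ x ∈ X, ∃ y ∈ Y, dist x y < infSetDist X Y + 1 / ((n : ℝ) + 1) :=
    fun n => exists_dist_lt_infSetDist_add hX hY Nat.one_div_pos_of_nat
  choose x hx y hy hlt using hxy
  refine ⟨x, y, hx, hy, tendsto_of_tendsto_of_tendsto_of_le_of_le tendsto_const_nhds
    (h := fun n : ℕ => infSetDist X Y + 1 / ((n : ℝ) + 1)) ?_
    (fun n => infSetDist_le_dist (hx n) (hy n)) (fun n => (hlt n).le)⟩
  simpa using tendsto_one_div_add_atTop_nhds_zero_nat.const_add (infSetDist X Y)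

theorem CATZero.minWellPosed {E : Type*} [MetricSpace E] [CompleteSpace E] (hcat : CATZero E)
    {X Y : Set E} (hX : X.Nonempty) (hXc : IsClosed X) (hXcv : GeodesicConvex X)
    (hY : Y.Nonempty) (hYb : IsBounded Y) (hYc : IsClosed Y)
    (h : sInf ((fun σ => diam (Lset Y X σ)) '' Ioi 0) = 0) : MinWellPosed X Y := by
  obtain ⟨u, v, hu, hv, huv⟩ := exists_tendsto_infSetDist hX hY
  obtain ⟨y₀, hvy₀⟩ := cauchySeq_tendsto_of_complete
    (cauchySeq_of_eventually_mem_Lset hYb h (eventually_mem_Lset hu hv huv))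
  have hy₀ : y₀ ∈ Y := hYc.mem_of_tendsto hvy₀ (Eventually.of_forall hv)
  obtain ⟨x₀, hx₀, hxy⟩ := hcat.exists_nearest hX hXc hXcv y₀
  have hinf : infDist y₀ X = infSetDist X Y := by
    refine le_antisymm (le_of_tendsto_of_tendsto' ((continuous_infDist_pt X).tendsto y₀ |>.comp hvy₀)
      huv fun n => ?_) (infSetDist_le_infDist hX hy₀)
    exact (infDist_le_dist_of_mem (hu n)).trans_eq (dist_comm _ _)
  have hlim : ∀ x y : ℕ → E, (∀ n, x n ∈ X) → (∀ n, y n ∈ Y) →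
      Tendsto (fun n => dist (x n) (y n)) atTop (nhds (infSetDist X Y)) →
      Tendsto x atTop (nhds x₀) ∧ Tendsto y atTop (nhds y₀) := by
    intro x y hx hy hd
    have hyy₀ : Tendsto y atTop (nhds y₀) := by
      rw [Metric.tendsto_nhds]
      intro ε hε
      obtain ⟨σ, hσ, hlt⟩ := exists_diam_Lset_lt h hε
      have hy₀σ : y₀ ∈ Lset Y X σ :=
        mem_Lset_of_dist_le hx₀ hy₀ (by rw [hxy, hinf]; exact le_add_of_nonneg_right hσ.le)
      filter_upwards [eventually_mem_Lset hx hy hd σ hσ] with n hn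
      exact (dist_le_diam_of_mem (hYb.subset (sep_subset _ _)) hn hy₀σ).trans_lt hlt
    refine ⟨?_, hyy₀⟩
    have hxy₀ : Tendsto (fun n => dist (x n) y₀) atTop (nhds (infDist y₀ X)) := by
      rw [hinf]
      refine tendsto_of_tendsto_of_tendsto_of_le_of_le tendsto_const_nhds
        (h := fun n => dist (x n) (y n) + dist (y n) y₀) ?_
        (fun n => infSetDist_le_dist (hx n) hy₀) (fun n => dist_triangle _ _ _)
      simpa using hd.add (tendsto_iff_dist_tendsto_zero.1 hyy₀)
    have hsq : Tendsto (fun n => dist (x n) x₀ ^ 2) atTop (nhds 0) := by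
      have h' : Tendsto (fun n => 2 * (dist (x n) y₀ ^ 2 - infDist y₀ X ^ 2)) atTop
          (nhds (2 * (infDist y₀ X ^ 2 - infDist y₀ X ^ 2))) :=
        ((hxy₀.pow 2).sub_const _).const_mul 2
      rw [sub_self, mul_zero] at h'
      refine squeeze_zero (fun n => by positivity) (fun n => ?_) h'
      simpa [hxy] using hcat.sq_dist_le hXcv (hx n) hx₀ y₀
    rw [tendsto_iff_dist_tendsto_zero]
    simpa [Real.sqrt_sq] using hsq.sqrt
  refine ⟨x₀, hx₀, y₀, hy₀, hxy.trans hinf, fun x hx y hy hd => ?_, hlim⟩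
  obtain ⟨h₁, h₂⟩ := hlim (fun _ => x) (fun _ => y) (fun _ => hx) (fun _ => hy)
    (by rw [hd]; exact tendsto_const_nhds)
  exact ⟨tendsto_nhds_unique tendsto_const_nhds h₁, tendsto_nhds_unique tendsto_const_nhds h₂⟩

/-- in a complete CAT(0) space, `min(X,Y)` is well-posed iff
`inf_{σ>0} diam L_{YX}(σ) = 0`. -/
theorem statement7 {E : Type*} [MetricSpace E] [CompleteSpace E] (hcat : CATZero E)
    (X Y : Set E) (hX : X.Nonempty) (hXb : IsBounded X) (hXc : IsClosed X)
    (hXcv : GeodesicConvex X) (hY : Y.Nonempty) (hYb : IsBounded Y) (hYc : IsClosed Y) :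
    MinWellPosed X Y ↔ sInf ((fun σ => diam (Lset Y X σ)) '' Ioi 0) = 0 := by
  exact ⟨fun h => h.sInf_diam_Lset hX, hcat.minWellPosed hX hXc hXcv hY hYb hYc⟩
end

section
/- Let (E,d) be a reflexive geodesic metric space with convex metric. Then E is complete. -/
open Metric Set Filter Bornology

/-- In a space with convex metric, the trace of a closed ball of the completion is convex. -/
theorem HasConvexMetric.geodesicConvex_preimage_closedBall {E : Type*} [MetricSpace E]
    (hconv : HasConvexMetric E) (z : UniformSpace.Completion E) (r : ℝ) :
    GeodesicConvex (((↑) : E → UniformSpace.Completion E) ⁻¹' closedBall z r) := by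
  rintro _ hx _ hy _ ⟨c, l, hc, rfl, rfl, rfl⟩ _ ⟨s, hs, rfl⟩
  simp only [mem_preimage, mem_closedBall] at hx hy ⊢
  obtain ⟨t, ht, rfl⟩ : ∃ t ∈ Icc (0:ℝ) 1, t * l = s := by
    rcases hc.1.eq_or_lt with h | h
    · exact ⟨0, by simp, by linarith [hs.1, hs.2]⟩
    · exact ⟨s / l, ⟨div_nonneg hs.1 h.le, (div_le_one h).2 hs.2⟩, div_mul_cancel₀ _ h.ne'⟩
  have dist_le (w : UniformSpace.Completion E) :
      dist (c (t * l) : UniformSpace.Completion E) w ≤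
        (1 - t) * dist (c 0 : UniformSpace.Completion E) w +
          t * dist (c l : UniformSpace.Completion E) w := by
    induction w using UniformSpace.Completion.induction_on with
    | hp => apply isClosed_le <;> fun_prop
    | ih y =>
      have hconst : IsGeodesicPath (fun _ => y) 0 :=
        ⟨le_rfl, fun a ha b hb => by
          simp [le_antisymm ha.2 ha.1, le_antisymm hb.2 hb.1]⟩
      simpa only [UniformSpace.Completion.dist_eq] using hconv c _ l 0 hc hconst t ht
  nlinarith [dist_le z, mul_le_mul_of_nonneg_left hx (sub_nonneg.2 ht.2),
    mul_le_mul_of_nonneg_left hy ht.1]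

/-- a reflexive geodesic metric space with convex metric is complete. -/
theorem statement8 {E : Type*} [MetricSpace E] (hgeo : IsGeodesicSpace E)
    (hconv : HasConvexMetric E) (hrefl : ReflexiveGeodesicSpace E) :
    CompleteSpace E := by
  have hsurj : Function.Surjective ((↑) : E → UniformSpace.Completion E) := by
    intro z
    obtain ⟨x, hx⟩ := hrefl
      (fun n => ((↑) : E → UniformSpace.Completion E) ⁻¹' closedBall z (1 / ((n : ℝ) + 1)))
      (fun n => by
        obtain ⟨x, hx⟩ := UniformSpace.Completion.denseRange_coe.exists_dist_lt z
          (Nat.one_div_pos_of_nat (α := ℝ) (n := n))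
        exact ⟨x, by simpa only [mem_preimage, mem_closedBall, dist_comm] using hx.le⟩)
      (fun n => UniformSpace.Completion.coe_isometry.antilipschitz.isBounded_preimage
        isBounded_closedBall)
      (fun n => isClosed_closedBall.preimage (UniformSpace.Completion.continuous_coe E))
      (fun n => hconv.geodesicConvex_preimage_closedBall z _)
      (fun n => preimage_mono <| closedBall_subset_closedBall <|
        Nat.one_div_le_one_div n.le_succ)
    exact ⟨x, dist_le_zero.1 <| ge_of_tendsto' tendsto_one_div_add_atTop_nhds_zero_nat
      fun n => mem_iInter.1 hx n⟩
  exact (UniformSpace.Completion.isUniformInducing_coe E).completeSpace_congr hsurj |>.2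
    inferInstance
end
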